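/- For every τ in the complex upper half plane, 2∑_{n=1}^∞ e^{πi(n²+2n)τ}/(1 − e^{2πinτ})² + ∑_{n=1}^∞ e^{πi(n²+n)τ}(1 + e^{2πinτ})/(1 − e^{2πinτ})² = ∑_{m>n>0} m e^{πimnτ} − ∑_{n>m>0} m e^{πimnτ}, where the right-hand sums run over pairs of positive integers (m,n) with m > n, respectively n > m. -/

import Mathlib

open Complex Real

theorem exp_pi_mul_natCast_eq_pow {τ z : ℂ} (k : ℕ) (hz : z = (π : ℂ) * I * (k : ℂ) * τ) :
    Complex.exp z = Complex.exp ((π : ℂ) * I * τ) ^ k := by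
  rw [← Complex.exp_nat_mul, hz]
  ring_nf

theorem norm_exp_pi_mul_I_lt_one {τ : ℂ} (hτ : 0 < τ.im) :
    ‖Complex.exp ((π : ℂ) * I * τ)‖ < 1 := by
  rw [Complex.norm_exp, Real.exp_lt_one_iff]
  have : ((π : ℂ) * I * τ).re = -(π * τ.im) := by simp
  rw [this, neg_lt_zero]
  exact mul_pos Real.pi_pos hτ

theorem one_sub_norm_le_norm_one_sub_pow {q : ℂ} (hq : ‖q‖ < 1) {k : ℕ} (hk : k ≠ 0) :
    1 - ‖q‖ ≤ ‖1 - q ^ k‖ := by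
  have h1 : ‖q‖ ^ k ≤ ‖q‖ := pow_le_of_le_one (norm_nonneg q) hq.le hk
  have h2 := norm_sub_norm_le (1 : ℂ) (q ^ k)
  rw [norm_one, norm_pow] at h2
  linarith

theorem one_sub_pow_ne_zero {q : ℂ} (hq : ‖q‖ < 1) {k : ℕ} (hk : k ≠ 0) : 1 - q ^ k ≠ 0 := by
  have h := one_sub_norm_le_norm_one_sub_pow hq hk
  exact norm_pos_iff.mp (by linarith)

theorem summable_pow_mul_div_one_sub_pow_sq {q : ℂ} (hq : ‖q‖ < 1) {a b : ℕ → ℕ} {c : ℕ → ℂ}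
    {C : ℝ} (ha : ∀ n, n ≤ a n) (hb : ∀ n, b n ≠ 0) (hc : ∀ n, ‖c n‖ ≤ C) :
    Summable fun n => q ^ a n * c n / (1 - q ^ b n) ^ 2 := by
  have hpos : 0 < 1 - ‖q‖ := by linarith
  refine Summable.of_norm_bounded
    (g := fun n => ‖q‖ ^ n * (C / (1 - ‖q‖) ^ 2))
    ((summable_geometric_of_lt_one (norm_nonneg q) hq).mul_right _) fun n => ?_
  have hC : 0 ≤ C := (norm_nonneg _).trans (hc n)
  rw [norm_div, norm_mul, norm_pow, norm_pow, ← mul_div_assoc]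
  have h1 := one_sub_norm_le_norm_one_sub_pow hq (hb n)
  have h2 : ‖q‖ ^ a n ≤ ‖q‖ ^ n := pow_le_pow_of_le_one (norm_nonneg q) hq.le (ha n)
  have h3 := hc n
  gcongr

/-- The double series `∑ m q ^ (m n)`, restricted to any set of pairs of positive integers,
converges absolutely. -/
theorem summable_ite_natCast_mul_pow_mul {q : ℂ} (hq : ‖q‖ < 1) (P : ℕ × ℕ → Prop)
    [DecidablePred P] (hP : ∀ p, P p → 0 < p.1 ∧ 0 < p.2) :
    Summable fun p : ℕ × ℕ => if P p then (p.1 : ℂ) * q ^ (p.1 * p.2) else 0 := by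
  rcases eq_or_ne q 0 with rfl | hq0
  · convert summable_zero with p
    split_ifs with h
    · have h' := hP p h
      simp [h'.1.ne', h'.2.ne']
    · rfl
  have hr : 0 < ‖q‖ := norm_pos_iff.mpr hq0
  have s1 : Summable fun m : ℕ => (m : ℝ) * ‖q‖ ^ m := by
    have := summable_pow_mul_geometric_of_norm_lt_one 1 (r := ‖q‖) (by simpa using hq)
    simpa using this
  have s2 := summable_geometric_of_lt_one (norm_nonneg q) hq
  have s := (s1.mul_of_nonneg s2 (fun m => by positivity) (fun m => by positivity)).mul_right ‖q‖⁻¹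
  refine Summable.of_norm_bounded s fun p => ?_
  split_ifs with h
  · obtain ⟨h1, h2⟩ := hP p h
    rw [norm_mul, norm_pow, Complex.norm_natCast, mul_assoc (p.1 : ℝ), mul_assoc (p.1 : ℝ)]
    gcongr
    rw [← pow_add, ← div_eq_mul_inv, le_div_iff₀ hr, ← pow_succ]
    refine pow_le_pow_of_le_one (norm_nonneg q) hq.le ?_
    obtain ⟨a, ha⟩ := Nat.exists_eq_add_of_lt h1
    obtain ⟨b, hb⟩ := Nat.exists_eq_add_of_lt h2
    rw [ha, hb]
    nlinarith [Nat.zero_le (a * b)]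
  · rw [norm_zero]
    positivity

/-- The difference of the two halves of `∑ m q ^ (m n)` above and below the diagonal,
as a single Lambert series. -/
theorem tsum_natCast_mul_pow_mul_sub_tsum {q : ℂ} (hq : ‖q‖ < 1) :
    (∑' p : ℕ × ℕ, if p.2 < p.1 ∧ 0 < p.2 then (p.1 : ℂ) * q ^ (p.1 * p.2) else 0)
      - (∑' p : ℕ × ℕ, if p.1 < p.2 ∧ 0 < p.1 then (p.1 : ℂ) * q ^ (p.1 * p.2) else 0)
    = ∑' n : ℕ, q ^ ((n + 1) ^ 2 + (n + 1)) / (1 - q ^ (n + 1)) ^ 2 := by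
  have s1 := summable_ite_natCast_mul_pow_mul hq (fun p => p.2 < p.1 ∧ 0 < p.2)
    (fun p h => ⟨h.2.trans h.1, h.2⟩)
  have s2 := summable_ite_natCast_mul_pow_mul hq (fun p => p.1 < p.2 ∧ 0 < p.1)
    (fun p h => ⟨h.2, h.2.trans h.1⟩)
  have s2' := (Equiv.prodComm ℕ ℕ).summable_iff.mpr s2
  rw [← (Equiv.prodComm ℕ ℕ).tsum_eq fun p : ℕ × ℕ =>
    if p.1 < p.2 ∧ 0 < p.1 then (p.1 : ℂ) * q ^ (p.1 * p.2) else 0]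
  have s := s1.sub s2'
  have ht := s1.tsum_sub s2'
  simp only [Function.comp_def] at s ht
  rw [← ht]
  have hinj : Function.Injective fun p : ℕ × ℕ => (p.1 + 1 + p.2, p.1 + 1) := by
    rintro ⟨a, b⟩ ⟨c, d⟩ h
    simp only [Prod.mk.injEq] at h ⊢
    omega
  have hcomp := hinj.tsum_eq (f := fun p : ℕ × ℕ =>
    (if p.2 < p.1 ∧ 0 < p.2 then (p.1 : ℂ) * q ^ (p.1 * p.2) else 0)
      - (if p.2 < p.1 ∧ 0 < p.2 then (p.2 : ℂ) * q ^ (p.2 * p.1) else 0)) (by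
    rintro ⟨m, n⟩ h
    rw [Function.mem_support] at h
    by_cases hmn : n < m ∧ 0 < n
    · refine ⟨(n - 1, m - n), ?_⟩
      simp only [Prod.mk.injEq]
      omega
    · simp [hmn] at h)
  have sc := s.comp_injective hinj
  refine (hcomp.symm.trans (sc.tsum_prod)).trans (tsum_congr fun n => ?_)
  have hn : ‖q ^ (n + 1)‖ < 1 := by
    rw [norm_pow]
    exact pow_lt_one₀ (norm_nonneg q) hq n.succ_ne_zero
  rw [pow_add, mul_div_assoc, ← tsum_coe_mul_geometric_of_norm_lt_one hn, ← tsum_mul_left]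
  refine tsum_congr fun k => ?_
  rcases Nat.eq_zero_or_pos k with rfl | hk
  · simp
  · have hk' : n + 1 < n + 1 + k ∧ 0 < n + 1 := by omega
    refine (congrArg₂ (· - ·) (if_pos hk') (if_pos hk')).trans ?_
    simp only [Equiv.prodComm_apply, Prod.swap_prod_mk]
    push_cast
    ring

/-- Lambert-type series rewritten as double theta-like sums. -/
theorem lambert_double_sum (τ : ℂ) (hτ : 0 < τ.im) :
    2 * (∑' n : ℕ, Complex.exp ((π : ℂ) * I * (((n : ℂ)+1)^2 + 2*((n : ℂ)+1)) * τ)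
          / (1 - Complex.exp (2 * (π : ℂ) * I * ((n : ℂ)+1) * τ))^2)
      + (∑' n : ℕ, Complex.exp ((π : ℂ) * I * (((n : ℂ)+1)^2 + ((n : ℂ)+1)) * τ)
          * (1 + Complex.exp (2 * (π : ℂ) * I * ((n : ℂ)+1) * τ))
          / (1 - Complex.exp (2 * (π : ℂ) * I * ((n : ℂ)+1) * τ))^2)
    = (∑' p : ℕ × ℕ, if p.2 < p.1 ∧ 0 < p.2 then
          (p.1 : ℂ) * Complex.exp ((π : ℂ) * I * (p.1 : ℂ) * (p.2 : ℂ) * τ) else 0)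
      - (∑' p : ℕ × ℕ, if p.1 < p.2 ∧ 0 < p.1 then
          (p.1 : ℂ) * Complex.exp ((π : ℂ) * I * (p.1 : ℂ) * (p.2 : ℂ) * τ) else 0) := by
  set q := Complex.exp ((π : ℂ) * I * τ) with hqdef
  have hq : ‖q‖ < 1 := norm_exp_pi_mul_I_lt_one hτ
  have e1 (n : ℕ) : Complex.exp ((π : ℂ) * I * (((n : ℂ)+1)^2 + 2*((n : ℂ)+1)) * τ)
      = q ^ ((n + 1) ^ 2 + 2 * (n + 1)) := exp_pi_mul_natCast_eq_pow _ (by push_cast; ring)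
  have e2 (n : ℕ) : Complex.exp (2 * (π : ℂ) * I * ((n : ℂ)+1) * τ) = q ^ (2 * (n + 1)) :=
    exp_pi_mul_natCast_eq_pow _ (by push_cast; ring)
  have e3 (n : ℕ) : Complex.exp ((π : ℂ) * I * (((n : ℂ)+1)^2 + ((n : ℂ)+1)) * τ)
      = q ^ ((n + 1) ^ 2 + (n + 1)) := exp_pi_mul_natCast_eq_pow _ (by push_cast; ring)
  have e4 (m n : ℕ) : Complex.exp ((π : ℂ) * I * (m : ℂ) * (n : ℂ) * τ) = q ^ (m * n) :=
    exp_pi_mul_natCast_eq_pow _ (by push_cast; ring)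
  simp only [e1, e2, e3, e4]
  rw [tsum_natCast_mul_pow_mul_sub_tsum hq, ← tsum_mul_left]
  have s1 := summable_pow_mul_div_one_sub_pow_sq hq (a := fun n => (n + 1) ^ 2 + 2 * (n + 1))
    (b := fun n => 2 * (n + 1)) (c := fun _ => 1) (C := 1)
    (fun n => by nlinarith) (fun n => by omega) (fun n => by simp)
  have s2 := summable_pow_mul_div_one_sub_pow_sq hq (a := fun n => (n + 1) ^ 2 + (n + 1))
    (b := fun n => 2 * (n + 1)) (c := fun n => 1 + q ^ (2 * (n + 1))) (C := 2)
    (fun n => by nlinarith) (fun n => by omega) (fun n => by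
      have h1 := norm_add_le (1 : ℂ) (q ^ (2 * (n + 1)))
      have h2 : ‖q‖ ^ (2 * (n + 1)) ≤ 1 := pow_le_one₀ (norm_nonneg q) hq.le
      rw [norm_one, norm_pow] at h1
      linarith)
  simp only [mul_one] at s1
  rw [← (s1.mul_left 2).tsum_add s2]
  refine tsum_congr fun n => ?_
  have h1 : 1 - q ^ (n + 1) ≠ 0 := one_sub_pow_ne_zero hq n.succ_ne_zero
  have h2 : 1 - q ^ (2 * (n + 1)) ≠ 0 := one_sub_pow_ne_zero hq (by omega)
  rw [pow_add _ _ (2 * (n + 1)), pow_add _ _ (n + 1), mul_comm 2 (n + 1), pow_mul q (n + 1) 2] at *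
  generalize q ^ (n + 1) = x at *
  generalize q ^ (n + 1) ^ 2 = y at *
  field_simp
  ring
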